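/- Let (M,F) be a non-regular A-foliation of codimension 2 on a compact, simply-connected (n+2)-manifold, let L_p be a least singular leaf (homeomorphic to Tⁿ⁻¹) and L_q a nearby principal leaf (homeomorphic to Tⁿ). Then the smooth circle bundle S¹ ↪ Tⁿ → Tⁿ⁻¹ given by the closest-point projection L_q → L_p is a principal S¹-bundle. -/

import Mathlib

open scoped Manifold unitInterval
open Topology

noncomputable section

/-- A singular foliation on a topological space `M`: a partition of `M` into connected
leaves, together with the dimension of the leaf through each point.  This records the
topological content of a singular Riemannian foliation (the metric conditions are part of
the ambient geometric setting). -/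
structure SFoliation (M : Type*) [TopologicalSpace M] where
  rel : M → M → Prop
  iseqv : Equivalence rel
  leafDim : M → ℕ
  leafDim_congr : ∀ {p q : M}, rel p q → leafDim p = leafDim q
  leaf_connected : ∀ p : M, IsConnected {q : M | rel p q}

namespace SFoliation

variable {M : Type*} [TopologicalSpace M] (F : SFoliation M)

/-- The leaf through `p`. -/
def leaf (p : M) : Set M := {q : M | F.rel p q}

lemma mem_leaf_self (p : M) : p ∈ F.leaf p := F.iseqv.refl p

/-- The setoid given by the partition into leaves. -/
def toSetoid : Setoid M := ⟨F.rel, F.iseqv⟩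

/-- The leaf space `M/F`, with the quotient topology. -/
def LeafSpace : Type _ := Quotient F.toSetoid

instance : TopologicalSpace F.LeafSpace := instTopologicalSpaceQuotient

/-- The leaf projection map. -/
def proj (p : M) : F.LeafSpace := Quotient.mk F.toSetoid p

lemma continuous_proj : Continuous F.proj := continuous_quotient_mk'

/-- The dimension of the foliation: the maximal dimension of its leaves. -/
def dim : ℕ := ⨆ p : M, F.leafDim p

/-- A point lies on a regular leaf if its leaf has maximal dimension. -/
def IsRegular (p : M) : Prop := ∀ q : M, F.leafDim q ≤ F.leafDim p

/-- A set is saturated if it is a union of leaves. -/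
def Saturated (U : Set M) : Prop := ∀ p ∈ U, F.leaf p ⊆ U

/-- A point lies on a principal leaf if its leaf is regular and has trivial holonomy,
encoded here by the existence of a saturated open product (foliated) trivialization
around the leaf. -/
def IsPrincipal (p : M) : Prop :=
  F.IsRegular p ∧
    ∃ U : Set M, IsOpen U ∧ p ∈ U ∧ F.Saturated U ∧
      ∃ e : ↥U ≃ₜ ↥(F.leaf p) × ↥(F.proj '' U),
        ∀ x : U, ((e x).2 : F.LeafSpace) = F.proj (x : M)

/-- The principal stratum: the union of the principal leaves. -/
def Mprin : Set M := {p : M | F.IsPrincipal p}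

/-- A continuous cross-section of the leaf projection. -/
def IsCrossSection (sec : C(F.LeafSpace, M)) : Prop := ∀ x : F.LeafSpace, F.proj (sec x) = x

end SFoliation

/-- A topological space is aspherical if all its homotopy groups in degrees `≥ 2` vanish. -/
def Aspherical (X : Type*) [TopologicalSpace X] : Prop :=
  ∀ n : ℕ, 2 ≤ n → ∀ x : X, Subsingleton (HomotopyGroup (Fin n) X x)

/-- An A-foliation: a singular (Riemannian) foliation all of whose leaves are closed
and aspherical. -/
structure SFoliation.IsAFoliation {M : Type*} [TopologicalSpace M] (F : SFoliation M) : Prop where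
  isClosed_leaf : ∀ p : M, IsClosed (F.leaf p)
  aspherical_leaf : ∀ p : M, Aspherical (F.leaf p)

/-- The standard `n`-torus `S¹ × ⋯ × S¹`. -/
abbrev Torus (n : ℕ) : Type := Fin n → Circle

/-- A foliated homeomorphism: a homeomorphism sending leaves onto leaves. -/
structure FoliatedHomeo {M₁ M₂ : Type*} [TopologicalSpace M₁] [TopologicalSpace M₂]
    (F₁ : SFoliation M₁) (F₂ : SFoliation M₂) extends M₁ ≃ₜ M₂ where
  leaf_rel : ∀ p q : M₁, F₁.rel p q ↔ F₂.rel (toHomeomorph p) (toHomeomorph q)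

section ExpData

variable {M : Type*} [TopologicalSpace M]

/-- Abstract normal exponential data along the leaf `L_p` of a singular foliation:
for each point `x` of the leaf, a map `exp x` from the normal space at `x`
(identified with `ℝᵏ`) into `M`. -/
structure LeafExpData (F : SFoliation M) (p : M) (k : ℕ) where
  exp : F.leaf p → EuclideanSpace ℝ (Fin k) → M
  exp_zero : ∀ x : F.leaf p, exp x 0 = (x : M)
  continuous_exp : ∀ x : F.leaf p, Continuous (exp x)

/-- The leaf of the infinitesimal foliation `F^p` (at the point `x` of the leaf `L_p`)
through the normal vector `v`: the connected component containing `v` of the preimage,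
under the normal exponential map, of the leaf of `F` through `exp x v`. -/
def LeafExpData.infLeaf {F : SFoliation M} {p : M} {k : ℕ} (E : LeafExpData F p k)
    (x : F.leaf p) (v : EuclideanSpace ℝ (Fin k)) : Set (EuclideanSpace ℝ (Fin k)) :=
  connectedComponentIn ((E.exp x) ⁻¹' (F.leaf (E.exp x v))) v

/-- Sliding data along a curve `γ` in the leaf `L_p` (Mendes–Radeschi): a continuous
family of linear isometries of the normal spaces, starting at the identity, preserving
the infinitesimal foliations, and such that `exp_{γ t} (s • G t v)` stays in the leaf
of `exp_{γ 0} (s • v)`. -/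
structure Sliding {F : SFoliation M} {p : M} {k : ℕ} (E : LeafExpData F p k)
    {x y : F.leaf p} (γ : Path x y) where
  G : unitInterval → (EuclideanSpace ℝ (Fin k) ≃ₗᵢ[ℝ] EuclideanSpace ℝ (Fin k))
  G_zero : G 0 = LinearIsometryEquiv.refl ℝ (EuclideanSpace ℝ (Fin k))
  continuous_G : Continuous fun tv : unitInterval × EuclideanSpace ℝ (Fin k) => G tv.1 tv.2
  foliated : ∀ (t : unitInterval) (v : EuclideanSpace ℝ (Fin k)),
    (G t) '' (E.infLeaf x v) = E.infLeaf (γ t) (G t v)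
  slides : ∀ (t : unitInterval) (s : ℝ) (v : EuclideanSpace ℝ (Fin k)),
    F.rel (E.exp (γ t) (s • (G t v))) (E.exp x (s • v))

end ExpData

/-- `f : E → B` is a (locally trivial) fiber bundle with fiber `Fib`. -/
def IsFiberBundleWithFiber (Fib : Type*) [TopologicalSpace Fib] {E B : Type*}
    [TopologicalSpace E] [TopologicalSpace B] (f : E → B) : Prop :=
  Continuous f ∧ Function.Surjective f ∧
    ∀ b : B, ∃ U : Set B, IsOpen U ∧ b ∈ U ∧
      ∃ e : ↥(f ⁻¹' U) ≃ₜ ↥U × Fib, ∀ x : ↥(f ⁻¹' U), ((e x).1 : B) = f (x : E)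

/-- `f : E → B` is a principal `S¹`-bundle with structure action `μ`: the `S¹`-action `μ`
is continuous and free, its orbits are exactly the fibers of `f`, and `f` admits
`S¹`-equivariant local trivializations. -/
def IsPrincipalCircleBundle {E B : Type*} [TopologicalSpace E] [TopologicalSpace B]
    (f : E → B) (μ : Circle → E → E) : Prop :=
  Continuous f ∧
    (Continuous fun zx : Circle × E => μ zx.1 zx.2) ∧
    (∀ x : E, μ 1 x = x) ∧
    (∀ (z w : Circle) (x : E), μ (z * w) x = μ z (μ w x)) ∧
    (∀ (z : Circle) (x : E), μ z x = x → z = 1) ∧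
    (∀ x y : E, f x = f y ↔ ∃ z : Circle, μ z x = y) ∧
    ∀ b : B, ∃ U : Set B, IsOpen U ∧ b ∈ U ∧
      ∃ e : ↥(f ⁻¹' U) ≃ₜ ↥U × Circle,
        (∀ x : ↥(f ⁻¹' U), ((e x).1 : B) = f (x : E)) ∧
        ∀ (z : Circle) (x : ↥(f ⁻¹' U)) (h : μ z (x : E) ∈ f ⁻¹' U),
          e ⟨μ z (x : E), h⟩ = ((e x).1, z * (e x).2)

lemma circleExp_natCast_mul (n : ℕ) (x : ℝ) : Circle.exp (n * x) = Circle.exp x ^ n := by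
  rw [← nsmul_eq_mul, Circle.exp_nsmul]

lemma circleExp_sum {ι : Type*} (s : Finset ι) (u : ι → ℝ) :
    Circle.exp (∑ i ∈ s, u i) = ∏ i ∈ s, Circle.exp (u i) := by
  classical
  induction s using Finset.induction_on with
  | empty => simp
  | insert i s hi ih => rw [Finset.sum_insert hi, Finset.prod_insert hi, Circle.exp_add, ih]

lemma eq_of_circleExp_eq_one {X : Type*} [TopologicalSpace X] [PreconnectedSpace X]
    {u : X → ℝ} (hu : Continuous u) (h : ∀ x, Circle.exp (u x) = 1) (x y : X) : u x = u y := by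
  have hsub : Set.range u ⊆ Set.range (fun m : ℤ => (m : ℝ) * (2 * Real.pi)) := by
    rintro _ ⟨x, rfl⟩
    obtain ⟨m, hm⟩ := Circle.exp_eq_one.1 (h x)
    exact ⟨m, hm.symm⟩
  exact (Set.countable_range _).isTotallyDisconnected _ hsub (isPreconnected_range hu)
    ⟨x, rfl⟩ ⟨y, rfl⟩

lemma eq_of_pow_eq_one {X : Type*} [TopologicalSpace X] [PreconnectedSpace X]
    {d : ℕ} (hd : 0 < d) {u : X → Circle} (hu : Continuous u) (h : ∀ x, u x ^ d = 1) (x y : X) :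
    u x = u y := by
  have hfin : {z : Circle | z ^ d = 1}.Finite := by
    refine ((Polynomial.nthRoots d (1 : ℂ)).toFinset.finite_toSet.preimage
      (f := fun z : Circle => (z : ℂ)) Subtype.val_injective.injOn).subset ?_
    intro z hz
    have hz' : z ^ d = 1 := hz
    simp only [Set.mem_preimage, Finset.mem_coe, Multiset.mem_toFinset]
    rw [Polynomial.mem_nthRoots hd, ← Circle.coe_pow, hz', Circle.coe_one]
  refine hfin.countable.isTotallyDisconnected _ ?_ (isPreconnected_range hu) ⟨x, rfl⟩ ⟨y, rfl⟩
  rintro _ ⟨x, rfl⟩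
  exact h x

/-- A power of the coordinate on the circle with a continuous logarithm is trivial. -/
lemma zpow_exponent_eq_zero {d : ℤ} {h : Circle → ℝ} (hh : Continuous h)
    (H : ∀ z : Circle, z ^ d = Circle.exp (h z)) : d = 0 := by
  have hc : Continuous fun t : ℝ => d * t - h (Circle.exp t) := by fun_prop
  have := eq_of_circleExp_eq_one hc (fun t => by
    rw [Circle.exp_sub, Circle.exp_intCast_mul, H, div_self']) (2 * Real.pi) 0
  simp only [Circle.exp_two_pi, Circle.exp_zero, mul_zero] at this
  have h2 : (d : ℝ) * (2 * Real.pi) = 0 := by linarith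
  have h3 := Real.pi_pos.ne'
  simpa [h3] using h2

/-- Every continuous map from a torus to the circle is a character times a map with a
continuous logarithm. -/
lemma exists_eq_prod_zpow_mul_exp {k : ℕ} {m : Torus k → Circle} (hm : Continuous m) :
    ∃ (a : Fin k → ℤ) (h : Torus k → ℝ), Continuous h ∧
      ∀ z, m z = (∏ i, z i ^ a i) * Circle.exp (h z) := by
  have hq : IsOpenQuotientMap (Pi.map fun (_ : Fin k) => (Circle.exp : ℝ → Circle)) :=
    .piMap fun _ => ⟨Circle.exp_surjective, Circle.exp.continuous,
      Circle.isCoveringMap_exp.isLocalHomeomorph.isOpenMap⟩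
  set q : (Fin k → ℝ) → Torus k := Pi.map fun (_ : Fin k) => (Circle.exp : ℝ → Circle) with hqdef
  obtain ⟨t₀, ht₀⟩ := Circle.exp_surjective (m (q 0))
  obtain ⟨F, ⟨-, hF⟩, -⟩ := Circle.isCoveringMap_exp.existsUnique_continuousMap_lifts
    (⟨m ∘ q, hm.comp hq.continuous⟩ : C(Fin k → ℝ, Circle)) 0 t₀ ht₀
  have hF' : ∀ x, Circle.exp (F x) = m (q x) := fun x => congrFun hF x
  have hqper : ∀ i x, q (x + Pi.single i (2 * Real.pi)) = q x := by
    intro i x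
    ext j : 1
    simp only [hqdef, Pi.map_apply, Pi.add_apply]
    by_cases hj : j = i
    · subst hj; simp
    · simp [hj]
  have hper : ∀ i, ∃ a : ℤ, ∀ x, F (x + Pi.single i (2 * Real.pi)) - F x = a * (2 * Real.pi) := by
    intro i
    have h1 : ∀ x, Circle.exp (F (x + Pi.single i (2 * Real.pi)) - F x) = 1 := by
      intro x
      rw [Circle.exp_sub, hF', hF', hqper, div_self']
    obtain ⟨a, ha⟩ := Circle.exp_eq_one.1 (h1 0)
    exact ⟨a, fun x => (eq_of_circleExp_eq_one (by fun_prop) h1 x 0).trans ha⟩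
  choose a ha using hper
  set L : C(Fin k → ℝ, ℝ) := ⟨fun x => F x - ∑ i, a i * x i, by fun_prop⟩ with hL
  let P : AddSubgroup (Fin k → ℝ) :=
    { carrier := {w | ∀ x, L (x + w) = L x}
      zero_mem' := fun x => by rw [add_zero]
      add_mem' := fun {v w} hv hw x => by rw [← add_assoc, hw, hv]
      neg_mem' := fun {v} hv x => by rw [← hv (x + -v), neg_add_cancel_right] }
  have hPs : ∀ i, Pi.single i (2 * Real.pi) ∈ P := by
    intro i x
    have h1 := ha i x
    have h2 : ∑ j, (a j : ℝ) * (x + Pi.single i (2 * Real.pi) : Fin k → ℝ) j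
        = ∑ j, (a j : ℝ) * x j + a i * (2 * Real.pi) := by
      simp only [Pi.add_apply, mul_add, Finset.sum_add_distrib]
      simp [Pi.single_apply]
    simp only [hL, ContinuousMap.coe_mk]
    rw [h2]
    linarith
  have hfac : Function.FactorsThrough L q := by
    intro x y hxy
    have h1 : ∀ i, ∃ n : ℤ, x i = y i + n * (2 * Real.pi) := fun i =>
      Circle.exp_eq_exp.1 (congrFun hxy i)
    choose n hn using h1
    have h2 : (∑ i, n i • Pi.single i (2 * Real.pi)) ∈ P :=
      P.sum_mem fun i _ => P.zsmul_mem (hPs i) _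
    have h3 : x = y + ∑ i, n i • Pi.single i (2 * Real.pi) := by
      ext j
      rw [hn j]
      simp [Finset.sum_apply, Pi.single_apply]
    rw [h3]
    exact h2 y
  obtain ⟨h, hh⟩ : ∃ h : C(Torus k, ℝ), ∀ x, h (q x) = L x := by
    let qc : C(Fin k → ℝ, Torus k) := ⟨q, hq.continuous⟩
    have hqc : IsQuotientMap qc := hq.isQuotientMap
    exact ⟨hqc.lift L hfac, fun x => congrArg (fun f => f x) (hqc.lift_comp L hfac)⟩
  refine ⟨a, h, h.continuous, fun z => ?_⟩
  obtain ⟨x, rfl⟩ := hq.surjective z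
  rw [← hF', hh]
  have h4 : ∏ i, q x i ^ a i = Circle.exp (∑ i, a i * x i) := by
    rw [circleExp_sum]
    simp [hqdef]
  rw [h4, ← Circle.exp_add]
  congr 1
  simp [hL]

lemma exists_eq_zpow_mul_exp {m : Circle → Circle} (hm : Continuous m) :
    ∃ (a : ℤ) (h : Circle → ℝ), Continuous h ∧ ∀ z, m z = z ^ a * Circle.exp (h z) := by
  obtain ⟨a, h, hh, H⟩ := exists_eq_prod_zpow_mul_exp (k := 1) (m := fun z => m (z 0))
    (by fun_prop)
  refine ⟨a 0, fun z => h fun _ => z, by fun_prop, fun z => ?_⟩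
  simpa using H fun _ => z

/-- A local trivialization of `f : E → B` with fiber the circle, given by its circle
coordinate `ψ` and its inverse `s`, both with arbitrary values outside the domain. -/
structure CircleChart {E B : Type*} [TopologicalSpace E] [TopologicalSpace B] (f : E → B) where
  U : Set B
  isOpen : IsOpen U
  ψ : E → Circle
  s : B × Circle → E
  continuousOn_ψ : ContinuousOn ψ (f ⁻¹' U)
  continuousOn_s : ContinuousOn s (U ×ˢ Set.univ)
  f_s : ∀ b ∈ U, ∀ z, f (s (b, z)) = b
  ψ_s : ∀ b ∈ U, ∀ z, ψ (s (b, z)) = z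
  s_f : ∀ x, f x ∈ U → s (f x, ψ x) = x

namespace CircleChart

variable {E B : Type*} [TopologicalSpace E] [TopologicalSpace B] {f : E → B}

lemma continuous_fiber (c : CircleChart f) {b : B} (hb : b ∈ c.U) :
    Continuous fun z => c.s (b, z) :=
  c.continuousOn_s.comp_continuous (by fun_prop) fun _ => ⟨hb, trivial⟩

lemma eq_s (c : CircleChart f) {b : B} {x : E} (hb : b ∈ c.U) (hx : f x = b) :
    x = c.s (b, c.ψ x) := by
  subst hx
  exact (c.s_f x hb).symm

lemma continuous_comp_fiber (c : CircleChart f) {Y : Type*} [TopologicalSpace Y] {V : Set B}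
    {g : E → Y} (hg : ContinuousOn g (f ⁻¹' V)) {b : B} (hb : b ∈ c.U) (hV : b ∈ V) :
    Continuous fun z => g (c.s (b, z)) :=
  hg.comp_continuous (c.continuous_fiber hb) fun z => by
    rw [Set.mem_preimage, c.f_s b hb]; exact hV

/-- Restriction of a chart to a smaller open set. -/
def restrict (c : CircleChart f) (V : Set B) (hV : IsOpen V) : CircleChart f where
  U := c.U ∩ V
  isOpen := c.isOpen.inter hV
  ψ := c.ψ
  s := c.s
  continuousOn_ψ := c.continuousOn_ψ.mono fun _ hx => hx.1
  continuousOn_s := c.continuousOn_s.mono fun _ hx => ⟨hx.1.1, trivial⟩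
  f_s b hb := c.f_s b hb.1
  ψ_s b hb := c.ψ_s b hb.1
  s_f x hx := c.s_f x hx.1

/-- The chart with the opposite orientation of the fibers. -/
def inv (c : CircleChart f) : CircleChart f where
  U := c.U
  isOpen := c.isOpen
  ψ x := (c.ψ x)⁻¹
  s y := c.s (y.1, y.2⁻¹)
  continuousOn_ψ := c.continuousOn_ψ.inv
  continuousOn_s := c.continuousOn_s.comp (by fun_prop) fun _ hx => ⟨hx.1, trivial⟩
  f_s b hb z := c.f_s b hb _
  ψ_s b hb z := by rw [c.ψ_s b hb, inv_inv]
  s_f x hx := by rw [inv_inv, c.s_f x hx]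

/-- On the domain of `c`, the function `φ` is the `d`-th power of the circle coordinate of `c`,
up to a factor with logarithm `g`. -/
def IsLog (c : CircleChart f) (φ : E → Circle) (d : ℕ) (g : E → ℝ) : Prop :=
  ContinuousOn g (f ⁻¹' c.U) ∧ ∀ x, f x ∈ c.U → φ x = c.ψ x ^ d * Circle.exp (g x)

lemma exists_isLog_of_chart (c : CircleChart f) {b : B} (hb : b ∈ c.U)
    {φ : E → Circle} (hφ : Continuous φ) :
    ∃ (c' : CircleChart f) (d : ℕ) (g : E → ℝ), b ∈ c'.U ∧ c'.IsLog φ d g := by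
  obtain ⟨D, k, hk, H⟩ := exists_eq_zpow_mul_exp (hφ.comp (c.continuous_fiber hb))
  simp only [Function.comp_apply] at H
  have hev : ∀ᶠ b' in 𝓝 b, ∀ z ∈ (Set.univ : Set Circle),
      ((φ (c.s (b', z)) / φ (c.s (b, z)) : Circle) : ℂ) ∈ Complex.slitPlane := by
    refine isCompact_univ.eventually_forall_of_forall_eventually fun z _ => ?_
    have h1 : ContinuousAt (fun y : B × Circle => c.s (y.1, y.2)) (b, z) :=
      c.continuousOn_s.continuousAt
        ((c.isOpen.prod isOpen_univ).mem_nhds (Set.mk_mem_prod hb trivial))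
    have h2 : ContinuousAt (fun y : B × Circle => c.s (b, y.2)) (b, z) :=
      ((c.continuous_fiber hb).comp continuous_snd).continuousAt
    have h3 : ContinuousAt (fun y : B × Circle =>
        ((φ (c.s (y.1, y.2)) / φ (c.s (b, y.2)) : Circle) : ℂ)) (b, z) :=
      continuous_subtype_val.continuousAt.comp
        ((hφ.continuousAt.comp h1).div' (hφ.continuousAt.comp h2))
    refine h3.eventually_mem (Complex.isOpen_slitPlane.mem_nhds ?_)
    simp
  obtain ⟨V, hV, hVo, hbV⟩ := eventually_nhds_iff.1 hev
  let g : E → ℝ := fun x => Complex.arg (φ x / φ (c.s (b, c.ψ x)) : Circle) + k (c.ψ x)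
  have hψ : ContinuousOn c.ψ (f ⁻¹' (c.U ∩ V)) := (c.restrict V hVo).continuousOn_ψ
  have hg : ContinuousOn g (f ⁻¹' (c.U ∩ V)) := by
    refine ContinuousOn.add ?_ (hk.comp_continuousOn hψ)
    intro x hx
    refine ContinuousAt.comp_continuousWithinAt (g := Complex.arg)
      (f := fun x => ((φ x / φ (c.s (b, c.ψ x)) : Circle) : ℂ)) ?_ ?_
    · refine Complex.continuousAt_arg ?_
      have := hV (f x) hx.2 (c.ψ x) trivial
      rwa [c.s_f x hx.1] at this
    · refine continuous_subtype_val.continuousAt.comp_continuousWithinAt ?_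
      exact ((hφ.continuousOn).div'
        ((hφ.comp (c.continuous_fiber hb)).comp_continuousOn hψ)) x hx
  have hval : ∀ x, f x ∈ c.U → φ x = c.ψ x ^ D * Circle.exp (g x) := by
    intro x _
    simp only [g]
    rw [Circle.exp_add, Circle.exp_arg, mul_left_comm, ← H, div_mul_cancel]
  rcases Int.eq_nat_or_neg D with ⟨d, rfl | rfl⟩
  · exact ⟨c.restrict V hVo, d, g, ⟨hb, hbV⟩, hg, fun x hx => by
      simpa [restrict] using hval x hx.1⟩
  · exact ⟨(c.restrict V hVo).inv, d, g, ⟨hb, hbV⟩, hg, fun x hx => by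
      simpa [inv, restrict] using hval x hx.1⟩

lemma IsLog.dvd {c c' : CircleChart f} {φ : E → Circle} {d d' : ℕ} {g g' : E → ℝ}
    (h : c.IsLog φ d g) (h' : c'.IsLog φ d' g') {b : B} (hb : b ∈ c.U) (hb' : b ∈ c'.U) :
    d' ∣ d := by
  obtain ⟨e, k, hk, H⟩ :=
    exists_eq_zpow_mul_exp (c.continuous_comp_fiber c'.continuousOn_ψ hb hb')
  have hg := c.continuous_comp_fiber h.1 hb hb
  have hg' := c.continuous_comp_fiber h'.1 hb hb'
  have h0 : ((d : ℤ) - e * d') = 0 := by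
    refine zpow_exponent_eq_zero
      (h := fun z => d' * k z + g' (c.s (b, z)) - g (c.s (b, z)))
      (((continuous_const.mul hk).add hg').sub hg) fun z => ?_
    have h1 := h.2 (c.s (b, z)) (by rwa [c.f_s b hb])
    have h2 := h'.2 (c.s (b, z)) (by rwa [c.f_s b hb])
    rw [h1, c.ψ_s b hb, H, mul_pow] at h2
    rw [Circle.exp_sub, Circle.exp_add, circleExp_natCast_mul,
      zpow_sub, zpow_mul, zpow_natCast, zpow_natCast, eq_div_iff_mul_eq',
      mul_right_comm, h2, mul_assoc ((z ^ e) ^ d')]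
    exact mul_inv_cancel_comm _ _
  exact Int.natCast_dvd_natCast.1 ⟨e, by linarith⟩

end CircleChart

lemma IsFiberBundleWithFiber.exists_chart {E B : Type*} [TopologicalSpace E] [TopologicalSpace B]
    {f : E → B} (hf : IsFiberBundleWithFiber Circle f) (b : B) :
    ∃ c : CircleChart f, b ∈ c.U := by
  classical
  obtain ⟨-, hs, hloc⟩ := hf
  obtain ⟨U, hU, hb, e, he⟩ := hloc b
  obtain ⟨x₀, -⟩ := hs b
  have hfs : ∀ y : U × Circle, f (e.symm y) = y.1 := fun y => by
    rw [← he, e.apply_symm_apply]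
  refine ⟨⟨U, hU, fun x => if h : f x ∈ U then (e ⟨x, h⟩).2 else 1,
    fun y => if h : y.1 ∈ U then e.symm (⟨y.1, h⟩, y.2) else x₀, ?_, ?_, ?_, ?_, ?_⟩, hb⟩
  · rw [continuousOn_iff_continuous_domRestrict]
    have : Continuous fun x : f ⁻¹' U => (e x).2 := by fun_prop
    refine this.congr fun x => ?_
    have hx : f x ∈ U := x.2
    simp [hx]
  · rw [continuousOn_iff_continuous_domRestrict]
    have : Continuous fun y : (U ×ˢ Set.univ : Set (B × Circle)) =>
        (e.symm (⟨y.1.1, y.2.1⟩, y.1.2) : E) := by fun_prop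
    refine this.congr fun y => ?_
    have hy : y.1.1 ∈ U := y.2.1
    simp [hy]
  · intro b hb z
    simp [hb, hfs]
  · intro b hb z
    simp [hb, hfs]
  · intro x hx
    have h1 : ((⟨f x, hx⟩, (e ⟨x, hx⟩).2) : U × Circle) = e ⟨x, hx⟩ :=
      Prod.ext (Subtype.ext (he ⟨x, hx⟩).symm) rfl
    simp [hx, h1]

lemma prod_zpow_eq_zpow_sum {ι G : Type*} [CommGroup G] (s : Finset ι) (x : G) (n : ι → ℤ) :
    ∏ i ∈ s, x ^ n i = x ^ ∑ i ∈ s, n i := by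
  classical
  induction s using Finset.induction_on with
  | empty => simp
  | insert i s hi ih => rw [Finset.sum_insert hi, Finset.prod_insert hi, zpow_add, ih]

lemma IsFiberBundleWithFiber.exists_charts_isLog {E B : Type*} [TopologicalSpace E]
    [TopologicalSpace B] [PreconnectedSpace B] {f : E → B}
    (hf : IsFiberBundleWithFiber Circle f) {φ : E → Circle} (hφ : Continuous φ) :
    ∃ (d : ℕ) (c : B → CircleChart f) (g : B → E → ℝ),
      ∀ b, b ∈ (c b).U ∧ (c b).IsLog φ d (g b) := by
  have h : ∀ b, ∃ (c : CircleChart f) (d : ℕ) (g : E → ℝ), b ∈ c.U ∧ c.IsLog φ d g := fun b => by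
    obtain ⟨c, hc⟩ := hf.exists_chart b
    exact c.exists_isLog_of_chart hc hφ
  choose c d g hb hlog using h
  have hd : IsLocallyConstant d := by
    refine (IsLocallyConstant.iff_eventually_eq d).2 fun b => ?_
    filter_upwards [(c b).isOpen.mem_nhds (hb b)] with b' hb'
    exact Nat.dvd_antisymm ((hlog b).dvd (hlog b') hb' (hb b'))
      ((hlog b').dvd (hlog b) (hb b') hb')
  rcases isEmpty_or_nonempty B with hB | ⟨⟨b₀⟩⟩
  · exact ⟨0, c, g, fun b => hB.elim b⟩
  · refine ⟨d b₀, c, g, fun b => ⟨hb b, ?_⟩⟩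
    rw [hd.apply_eq_of_preconnectedSpace b₀ b]
    exact hlog b

/-- The average of a family of functions on the total space with weights a partition of unity
on the base. -/
def PartitionOfUnity.average {E B ι : Type*} [TopologicalSpace B]
    (ρ : PartitionOfUnity ι B) (f : E → B) (g : ι → E → ℝ) (x : E) : ℝ :=
  ∑ i ∈ ρ.finsupport (f x), ρ i (f x) * g i x

lemma PartitionOfUnity.continuous_average {E B ι : Type*} [TopologicalSpace E]
    [TopologicalSpace B] {ρ : PartitionOfUnity ι B} {U : ι → Set B}
    (hρ : ρ.IsSubordinate U) (hU : ∀ i, IsOpen (U i)) {f : E → B} (hf : Continuous f)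
    {g : ι → E → ℝ} (hg : ∀ i, ContinuousOn (g i) (f ⁻¹' U i)) :
    Continuous (ρ.average f g) := by
  let ρ' : PartitionOfUnity ι E :=
    { toFun := fun i => (ρ i).comp ⟨f, hf⟩
      locallyFinite' := ρ.locallyFinite.preimage_continuous hf
      nonneg' := fun i x => ρ.nonneg i (f x)
      sum_eq_one' := fun x _ => ρ.sum_eq_one (x := f x) trivial
      sum_le_one' := fun x => ρ.sum_le_one (f x) }
  have h : Continuous fun x => ∑ᶠ i, ρ' i x • g i x := by
    refine ρ'.continuous_finsum_smul fun i x hx => ?_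
    have hx' : f x ∈ tsupport (ρ i) := tsupport_comp_subset_preimage (ρ i) hf hx
    exact (hg i).continuousAt (((hU i).preimage hf).mem_nhds (hρ i hx'))
  refine h.congr fun x => ?_
  exact (ρ.sum_finsupport_smul_eq_finsum (x₀ := f x) (φ := fun i _ => g i x)).symm

lemma PartitionOfUnity.IsSubordinate.mem {B ι : Type*} [TopologicalSpace B]
    {ρ : PartitionOfUnity ι B} {U : ι → Set B} (hρ : ρ.IsSubordinate U) {i : ι} {b : B}
    (hi : i ∈ ρ.finsupport b) : b ∈ U i :=
  hρ i (subset_tsupport _ ((ρ.mem_finsupport b).1 hi))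

/-- A map with a continuous logarithm along each fiber is the product of a map pulled back
from the base and a map with a global continuous logarithm. -/
lemma exists_eq_comp_mul_exp {E B : Type*} [TopologicalSpace E] [TopologicalSpace B]
    [T2Space B] [CompactSpace B] {f : E → B} (hf : Continuous f) {φ : E → Circle}
    (hφ : Continuous φ) {c : B → CircleChart f} {g : B → E → ℝ}
    (hc : ∀ b, b ∈ (c b).U ∧ (c b).IsLog φ 0 (g b)) :
    ∃ (m : B → Circle) (h : E → ℝ), Continuous m ∧ Continuous h ∧
      ∀ x, φ x = m (f x) * Circle.exp (h x) := by
  obtain ⟨ρ, hρ⟩ := PartitionOfUnity.exists_isSubordinate isClosed_univ (fun b => (c b).U)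
    (fun b => (c b).isOpen) (fun b _ => Set.mem_iUnion.2 ⟨b, (hc b).1⟩)
  let g' : B → E → ℝ := fun i x => g i x - g i ((c i).s (f x, 1))
  have hg' : ∀ i, ContinuousOn (g' i) (f ⁻¹' (c i).U) := by
    intro i
    refine (hc i).2.1.sub ((hc i).2.1.comp ((c i).continuousOn_s.comp
      (by fun_prop) fun x hx => ⟨hx, trivial⟩) fun x hx => ?_)
    have hx' : f x ∈ (c i).U := hx
    simpa [(c i).f_s _ hx'] using hx'
  have hh := PartitionOfUnity.continuous_average hρ (fun b => (c b).isOpen) hf hg'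
  set h : E → ℝ := ρ.average f g'
  have hexp : ∀ (i : B) (x : E), f x ∈ (c i).U → φ x = Circle.exp (g i x) := fun i x hx => by
    simpa using (hc i).2.2 x hx
  have hdiff : ∀ (i : B) (x y : E), f x = f y → f x ∈ (c i).U → ∀ j, f x ∈ (c j).U →
      g i x - g j x = g i y - g j y := by
    intro i x y hxy hi j hj
    have h1 := (c i).continuous_comp_fiber (hc i).2.1 hi hi
    have h2 := (c i).continuous_comp_fiber (hc j).2.1 hi hj
    have h3 := eq_of_circleExp_eq_one (h1.sub h2) (fun z => by
      have hz : f ((c i).s (f x, z)) = f x := (c i).f_s _ hi z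
      simp only [Pi.sub_apply]
      rw [Circle.exp_sub, ← hexp i _ (by rwa [hz]), ← hexp j _ (by rwa [hz]), div_self'])
      ((c i).ψ x) ((c i).ψ y)
    simpa only [Pi.sub_apply, ← (c i).eq_s hi rfl, ← (c i).eq_s hi hxy.symm] using h3
  have hfib : ∀ x y, f x = f y → φ x / Circle.exp (h x) = φ y / Circle.exp (h y) := by
    intro x y hxy
    have hi : f x ∈ (c (f x)).U := (hc (f x)).1
    have h1 : h x - h y = g (f x) x - g (f x) y := by
      simp only [h, PartitionOfUnity.average]
      rw [← hxy, ← Finset.sum_sub_distrib, ← one_mul (g (f x) x - g (f x) y),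
        ← ρ.sum_finsupport (x₀ := f x) trivial, Finset.sum_mul]
      refine Finset.sum_congr rfl fun j hj => ?_
      have := hdiff (f x) x y hxy hi j (hρ.mem hj)
      have h2 : g' j x - g' j y = g j x - g j y := by
        simp only [g', hxy]
        ring
      rw [← mul_sub, h2]
      congr 1
      linarith
    rw [hexp _ x hi, hexp (f x) y (hxy ▸ hi), ← Circle.exp_sub, ← Circle.exp_sub]
    congr 1
    linarith
  let m : B → Circle := fun b => φ ((c b).s (b, 1)) / Circle.exp (h ((c b).s (b, 1)))
  have hm : ∀ x, m (f x) = φ x / Circle.exp (h x) := fun x =>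
    hfib _ _ ((c (f x)).f_s _ (hc (f x)).1 1)
  refine ⟨m, h, ?_, hh, fun x => by rw [hm, div_mul_cancel]⟩
  refine continuous_iff_continuousAt.2 fun b => ?_
  have h1 : ContinuousOn (fun b' => (c b).s (b', (1 : Circle))) (c b).U :=
    (c b).continuousOn_s.comp (by fun_prop) fun x hx => ⟨hx, trivial⟩
  have h2 : Continuous fun x => φ x / Circle.exp (h x) := by fun_prop
  refine ((h2.comp_continuousOn h1).continuousAt
    ((c b).isOpen.mem_nhds (hc b).1)).congr ?_
  filter_upwards [(c b).isOpen.mem_nhds (hc b).1] with b' hb'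
  simp only [Function.comp_apply]
  rw [← hm, (c b).f_s b' hb']

/-- A circle bundle over a `k`-torus with total space a `(k + 1)`-torus carries a map to the
circle of nonzero degree on the fibers. -/
lemma exists_charts_isLog_pos {E B : Type*} [TopologicalSpace E] [TopologicalSpace B] {k : ℕ}
    (α : E ≃ₜ Torus (k + 1)) (β : B ≃ₜ Torus k) {f : E → B}
    (hf : IsFiberBundleWithFiber Circle f) :
    ∃ (φ : E → Circle) (d : ℕ) (c : B → CircleChart f) (g : B → E → ℝ), 0 < d ∧ Continuous φ ∧
      ∀ b, b ∈ (c b).U ∧ (c b).IsLog φ d (g b) := by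
  have : T2Space B := β.symm.t2Space
  have : CompactSpace B := β.symm.compactSpace
  have : ConnectedSpace B := β.connectedSpace_iff.2 inferInstance
  by_contra! hcon
  have key : ∀ j : Fin (k + 1), ∃ (a : Fin k → ℤ) (h : E → ℝ), Continuous h ∧
      ∀ x, α x j = (∏ i, β (f x) i ^ a i) * Circle.exp (h x) := by
    intro j
    have hφ : Continuous fun x => α x j := by fun_prop
    obtain ⟨d, c, g, hc⟩ := hf.exists_charts_isLog hφ
    obtain rfl : d = 0 := by
      by_contra hd
      obtain ⟨b, hb⟩ := hcon _ d c g (Nat.pos_of_ne_zero hd) hφ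
      exact hb (hc b).1 (hc b).2
    obtain ⟨m, h, hm, hh, H⟩ := exists_eq_comp_mul_exp hf.1 hφ hc
    obtain ⟨a, h', hh', H'⟩ := exists_eq_prod_zpow_mul_exp (hm.comp β.symm.continuous)
    refine ⟨a, fun x => h' (β (f x)) + h x, ?_, fun x => ?_⟩
    · have := hf.1
      fun_prop
    · have := H' (β (f x))
      simp only [Function.comp_apply, Homeomorph.symm_apply_apply] at this
      rw [H, this, Circle.exp_add, mul_assoc]
  choose a h hh H using key
  have hdep : ¬ LinearIndependent ℤ a := fun hli => by
    have := hli.fintype_card_le_finrank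
    simp at this
  obtain ⟨n, hn, j₀, hj₀⟩ := Fintype.not_linearIndependent_iff.1 hdep
  have hprod : ∀ x, ∏ j, α x j ^ n j = Circle.exp (∑ j, n j * h j x) := by
    intro x
    have h1 : ∏ j, (∏ i, β (f x) i ^ a j i) ^ n j = 1 := by
      simp_rw [← Finset.prod_zpow, ← zpow_mul]
      rw [Finset.prod_comm]
      refine Finset.prod_eq_one fun i _ => ?_
      rw [prod_zpow_eq_zpow_sum]
      have := congrFun hn i
      simp only [Finset.sum_apply, Pi.smul_apply, smul_eq_mul, Pi.zero_apply] at this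
      simp_rw [mul_comm (a _ i), this, zpow_zero]
    simp_rw [H, mul_zpow, Finset.prod_mul_distrib]
    rw [h1, one_mul, circleExp_sum]
    simp
  refine hj₀ (zpow_exponent_eq_zero
    (h := fun z => ∑ j, n j * h j (α.symm (Pi.mulSingle j₀ z))) ?_ fun z => ?_)
  · have : Continuous fun z : Circle => α.symm (Pi.mulSingle j₀ z) :=
      α.symm.continuous.comp (continuous_mulSingle (A := fun _ : Fin (k + 1) => Circle) j₀)
    exact continuous_finsetSum _ fun j _ => continuous_const.mul ((hh j).comp this)
  · rw [← hprod, Homeomorph.apply_symm_apply, Finset.prod_eq_single j₀]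
    · simp
    · intro j _ hj
      simp [hj]
    · simp

lemma bijective_mul_exp_of_strictMono {k : Circle → ℝ} (hk : Continuous k)
    (hmono : StrictMono fun t : ℝ => t + k (Circle.exp t)) :
    Function.Bijective fun z : Circle => z * Circle.exp (k z) := by
  have hexp : ∀ t : ℝ, Circle.exp t * Circle.exp (k (Circle.exp t))
      = Circle.exp (t + k (Circle.exp t)) := fun t => (Circle.exp_add _ _).symm
  constructor
  · intro z w hzw
    obtain ⟨t, rfl⟩ := Circle.exp_surjective z
    obtain ⟨r, rfl⟩ := Circle.exp_surjective w
    simp only [hexp] at hzw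
    obtain ⟨n, hn⟩ := Circle.exp_eq_exp.1 hzw
    have h1 : Circle.exp (r + n * (2 * Real.pi)) = Circle.exp r :=
      Circle.exp_eq_exp.2 ⟨n, rfl⟩
    have h2 : t = r + n * (2 * Real.pi) := hmono.injective (by simp only [h1]; linarith)
    rw [h2, h1]
  · intro w
    have hcont : Continuous fun t : ℝ => t + k (Circle.exp t) := by fun_prop
    have h2 : 0 < 2 * Real.pi := Real.two_pi_pos
    obtain ⟨r, rfl⟩ := Circle.exp_surjective w
    set a := toIcoMod h2 (k 1) r with ha
    have haI := toIcoMod_mem_Ico h2 (k 1) r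
    have haw : Circle.exp a = Circle.exp r :=
      Circle.exp_eq_exp.2 ⟨-toIcoDiv h2 (k 1) r, by
        rw [ha, toIcoMod, zsmul_eq_mul]; push_cast; ring⟩
    obtain ⟨t, -, ht⟩ := intermediate_value_Icc h2.le hcont.continuousOn
      (show a ∈ Set.Icc _ _ by
        simp only [Circle.exp_zero, Circle.exp_two_pi, zero_add]
        exact ⟨haI.1, by linarith [haI.2]⟩)
    exact ⟨Circle.exp t, by simp only [hexp]; rw [← haw, ← ht]⟩

/-- A continuous family of bijections from a compact space to a Hausdorff space has a
continuous family of inverses. -/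
lemma continuous_of_leftInverse_fiberwise {X Y Z : Type*} [TopologicalSpace X]
    [TopologicalSpace Y] [TopologicalSpace Z] [CompactSpace Y] [T2Space Z] {θ : X × Y → Z}
    (hθ : Continuous θ) {η : X × Z → Y} (h : ∀ x y z, θ (x, y) = z ↔ y = η (x, z)) :
    Continuous η := by
  refine continuous_iff_isClosed.2 fun C hC => ?_
  have hS : IsClosed {w : (X × Z) × Y | w.2 ∈ C ∧ θ (w.1.1, w.2) = w.1.2} :=
    (hC.preimage continuous_snd).inter (isClosed_eq (by fun_prop) (by fun_prop))
  convert isClosedMap_fst_of_compactSpace _ hS using 1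
  ext w
  constructor
  · exact fun hw => ⟨(w, η w), ⟨hw, (h _ _ _).2 rfl⟩, rfl⟩
  · rintro ⟨⟨w', y⟩, ⟨hy, hw⟩, rfl⟩
    rw [h] at hw
    rw [Set.mem_preimage, ← hw]
    exact hy

namespace CircleChart

variable {E B : Type*} [TopologicalSpace E] [TopologicalSpace B] {f : E → B}

/-- Multiplying the circle coordinate of a chart by `exp K`, where `K` is real-valued, yields a
chart as soon as the coordinate stays monotone along the fibers. -/
lemma exists_chart_mul_exp (c : CircleChart f) {K : E → ℝ} (hK : ContinuousOn K (f ⁻¹' c.U))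
    (hmono : ∀ b ∈ c.U, StrictMono fun t : ℝ => t + K (c.s (b, Circle.exp t))) :
    ∃ c' : CircleChart f, c'.U = c.U ∧ ∀ x, c'.ψ x = c.ψ x * Circle.exp (K x) := by
  classical
  have hbij : ∀ b : c.U,
      Function.Bijective fun z : Circle => z * Circle.exp (K (c.s (b, z))) := fun b =>
    bijective_mul_exp_of_strictMono (c.continuous_comp_fiber hK b.2 b.2) (hmono b b.2)
  let e : c.U → Circle ≃ Circle := fun b => Equiv.ofBijective _ (hbij b)
  have hsU : Continuous fun y : c.U × Circle => c.s (y.1, y.2) :=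
    c.continuousOn_s.comp_continuous (by fun_prop) fun y => ⟨y.1.2, trivial⟩
  have hKs : Continuous fun y : c.U × Circle => K (c.s (y.1, y.2)) :=
    hK.comp_continuous hsU fun y => by
      rw [Set.mem_preimage, c.f_s _ y.1.2]; exact y.1.2
  have he : ∀ b z, e b z = z * Circle.exp (K (c.s (b, z))) := fun _ _ => rfl
  have hη : Continuous fun y : c.U × Circle => (e y.1).symm y.2 :=
    continuous_of_leftInverse_fiberwise
      (θ := fun y : c.U × Circle => y.2 * Circle.exp (K (c.s (y.1, y.2))))
      (continuous_snd.mul (Circle.exp.continuous.comp hKs))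
      fun b z w => by rw [Equiv.eq_symm_apply]; rfl
  refine ⟨⟨c.U, c.isOpen, fun x => c.ψ x * Circle.exp (K x),
    fun y => if h : y.1 ∈ c.U then c.s (y.1, (e ⟨y.1, h⟩).symm y.2) else c.s y,
    c.continuousOn_ψ.mul (Circle.exp.continuous.comp_continuousOn hK), ?_, ?_, ?_, ?_⟩,
    rfl, fun _ => rfl⟩
  · rw [continuousOn_iff_continuous_domRestrict]
    have h1 : Continuous fun y : (c.U ×ˢ Set.univ : Set (B × Circle)) =>
        ((⟨y.1.1, y.2.1⟩, y.1.2) : c.U × Circle) := by fun_prop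
    refine (hsU.comp ((continuous_fst.prodMk hη).comp h1)).congr fun y => ?_
    have hy : y.1.1 ∈ c.U := y.2.1
    simp [hy]
  · intro b hb z
    simp [hb, c.f_s]
  · intro b hb z
    have := he ⟨b, hb⟩ ((e ⟨b, hb⟩).symm z)
    rw [Equiv.apply_symm_apply] at this
    simp only [hb, dif_pos, c.ψ_s b hb]
    exact this.symm
  · intro x hx
    have h1 : (e ⟨f x, hx⟩).symm (c.ψ x * Circle.exp (K x)) = c.ψ x := by
      rw [Equiv.symm_apply_eq, he, c.s_f x hx]
    simp only [hx, dif_pos, h1, c.s_f x hx]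

end CircleChart

/-- Charts whose circle coordinates are all `d`-th roots of one function differ by constant
rotations of the fibers, so they define a principal bundle. -/
lemma exists_isPrincipalCircleBundle_of_pow_eq {E B : Type*} [TopologicalSpace E]
    [TopologicalSpace B] {f : E → B} (hf : Continuous f) {d : ℕ} (hd : 0 < d) {φ : E → Circle}
    (c : B → CircleChart f) (hc : ∀ b, b ∈ (c b).U)
    (hφ : ∀ b x, f x ∈ (c b).U → (c b).ψ x ^ d = φ x) :
    ∃ μ : Circle → E → E, IsPrincipalCircleBundle f μ := by
  have hratio : ∀ i j x y, f x ∈ (c i).U → f x ∈ (c j).U → f y = f x →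
      (c i).ψ x / (c j).ψ x = (c i).ψ y / (c j).ψ y := by
    intro i j x y hi hj hxy
    have h1 := (c i).continuous_comp_fiber (c i).continuousOn_ψ hi hi
    have h2 := (c i).continuous_comp_fiber (c j).continuousOn_ψ hi hj
    have h3 := eq_of_pow_eq_one hd (h1.div' h2) (fun z => by
      have hz : f ((c i).s (f x, z)) = f x := (c i).f_s _ hi z
      simp only [Pi.div_apply]
      rw [div_pow, hφ i _ (by rwa [hz]), hφ j _ (by rwa [hz]), div_self'])
      ((c i).ψ x) ((c i).ψ y)
    simpa only [Pi.div_apply, ← (c i).eq_s hi rfl, ← (c i).eq_s hi hxy] using h3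
  let μ : Circle → E → E := fun z x => (c (f x)).s (f x, z * (c (f x)).ψ x)
  have hμ : ∀ i z x, f x ∈ (c i).U → μ z x = (c i).s (f x, z * (c i).ψ x) := by
    intro i z x hi
    set y := (c i).s (f x, z * (c i).ψ x) with hy
    have hfy : f y = f x := (c i).f_s _ hi _
    have h1 := hratio i (f x) x y hi (hc _) hfy
    rw [hy, (c i).ψ_s _ hi, ← hy, div_eq_div_iff_mul_eq_mul, mul_comm z, mul_assoc,
      mul_right_inj] at h1
    rw [(c (f x)).eq_s (hc (f x)) hfy, h1]
  have hfμ : ∀ z x, f (μ z x) = f x := fun z x => (c (f x)).f_s _ (hc _) _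
  have hψμ : ∀ i z x, f x ∈ (c i).U → (c i).ψ (μ z x) = z * (c i).ψ x := fun i z x hi => by
    rw [hμ i z x hi, (c i).ψ_s _ hi]
  have hinj : ∀ i x y, f x ∈ (c i).U → f y = f x → (c i).ψ x = (c i).ψ y → x = y :=
    fun i x y hi hxy h => by
      rw [(c i).eq_s hi rfl, h, ← (c i).eq_s hi hxy]
  refine ⟨μ, hf, ?_, ?_, ?_, ?_, ?_, ?_⟩
  · refine continuous_iff_continuousAt.2 fun y => ?_
    set V : Set (Circle × E) := {y' | f y'.2 ∈ (c (f y.2)).U} with hV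
    have hVo : IsOpen V := (c (f y.2)).isOpen.preimage (hf.comp continuous_snd)
    have h1 : ContinuousOn (fun y' : Circle × E => (c (f y.2)).ψ y'.2) V :=
      (c (f y.2)).continuousOn_ψ.comp continuousOn_snd fun _ h => h
    have h2 : ContinuousOn (fun y' : Circle × E => μ y'.1 y'.2) V := by
      refine ((c (f y.2)).continuousOn_s.comp
        ((hf.comp continuous_snd).continuousOn.prodMk (continuousOn_fst.mul h1))
        fun y' h => ⟨h, trivial⟩).congr fun y' h => hμ _ _ _ h
    exact h2.continuousAt (hVo.mem_nhds (hc _))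
  · intro x
    simp only [μ, one_mul, (c (f x)).s_f x (hc _)]
  · intro z w x
    have hi : f x ∈ (c (f x)).U := hc _
    refine hinj (f x) _ _ (by rwa [hfμ]) (by simp only [hfμ]) ?_
    rw [hψμ _ _ _ hi, hψμ _ _ _ (by rwa [hfμ]), hψμ _ _ _ hi, mul_assoc]
  · intro z x h
    have := hψμ (f x) z x (hc _)
    rw [h] at this
    exact right_eq_mul.1 this
  · refine fun x y => ⟨fun h => ⟨(c (f x)).ψ y / (c (f x)).ψ x, ?_⟩, ?_⟩
    · refine hinj (f x) _ _ (by rw [hfμ]; exact hc _) (by rw [hfμ, h]) ?_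
      rw [hψμ _ _ _ (hc _), div_mul_cancel]
    · rintro ⟨z, rfl⟩
      rw [hfμ]
  · intro b
    refine ⟨(c b).U, (c b).isOpen, hc b, ?_⟩
    have hψ : Continuous fun x : f ⁻¹' (c b).U => (c b).ψ x :=
      continuousOn_iff_continuous_domRestrict.1 (c b).continuousOn_ψ
    have hs : Continuous fun y : (c b).U × Circle => (c b).s (y.1, y.2) :=
      (c b).continuousOn_s.comp_continuous (by fun_prop) fun y => ⟨y.1.2, trivial⟩
    refine ⟨{ toFun := fun x => (⟨f x, x.2⟩, (c b).ψ x)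
              invFun := fun y => ⟨(c b).s (y.1, y.2), by
                rw [Set.mem_preimage, (c b).f_s _ y.1.2]; exact y.1.2⟩
              left_inv := fun x => Subtype.ext ((c b).s_f x x.2)
              right_inv := fun y => Prod.ext (Subtype.ext ((c b).f_s _ y.1.2 _))
                ((c b).ψ_s _ y.1.2 _)
              continuous_toFun := by fun_prop
              continuous_invFun := by fun_prop }, fun x => rfl, fun z x h => ?_⟩
    exact Prod.ext (Subtype.ext (hfμ z x)) (hψμ b z x x.2)

/-- The coordinate of a chart, compared through `d`-th powers with the coordinate of another
chart, is monotone. -/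
lemma CircleChart.strictMono_of_isLog {E B : Type*} [TopologicalSpace E] [TopologicalSpace B]
    {f : E → B} {c c' : CircleChart f} {φ : E → Circle} {d : ℕ} (hd : 0 < d) {g g' : E → ℝ}
    (h : c.IsLog φ d g) (h' : c'.IsLog φ d g') {b : B} (hb : b ∈ c.U) (hb' : b ∈ c'.U) :
    StrictMono fun t : ℝ =>
      t + (g (c.s (b, Circle.exp t)) - g' (c.s (b, Circle.exp t))) / d := by
  have hg := (c.continuous_comp_fiber h.1 hb hb).comp Circle.exp.continuous
  have hg' := (c.continuous_comp_fiber h'.1 hb hb').comp Circle.exp.continuous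
  have hψ := (c.continuous_comp_fiber c'.continuousOn_ψ hb hb').comp Circle.exp.continuous
  have hd' : (d : ℝ) ≠ 0 := by positivity
  set x : ℝ → E := fun t => c.s (b, Circle.exp t) with hx
  have hfx : ∀ t, f (x t) = b := fun t => c.f_s b hb _
  set F : ℝ → ℝ := fun t => t + (g (x t) - g' (x t)) / d with hF
  have hFc : Continuous F := continuous_id.add ((hg.sub hg').div_const _)
  have hconst : ∀ t r, c'.ψ (x t) / Circle.exp (F t) = c'.ψ (x r) / Circle.exp (F r) := by
    refine eq_of_pow_eq_one hd (hψ.div' (Circle.exp.continuous.comp hFc)) fun t => ?_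
    have h1 := h.2 (x t) (by rwa [hfx])
    have h2 := h'.2 (x t) (by rwa [hfx])
    rw [h1, c.ψ_s b hb] at h2
    have h3 : (d : ℝ) * F t = d * t + g (x t) - g' (x t) := by
      simp only [hF]
      field_simp
      ring
    change (c'.ψ (x t) / Circle.exp (F t)) ^ d = 1
    rw [div_pow, ← circleExp_natCast_mul, h3, Circle.exp_sub, Circle.exp_add,
      circleExp_natCast_mul, h2, mul_div_cancel_right, div_self']
  have hinj : Function.Injective F := by
    intro t r htr
    have h1 := hconst t r
    rw [htr, div_left_inj] at h1
    have h2 : x t = x r := by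
      rw [c'.eq_s hb' (hfx t), h1, ← c'.eq_s hb' (hfx r)]
    simpa only [hF, h2, add_left_inj] using htr
  rcases hFc.strictMono_of_inj hinj with hm | hm
  · exact hm
  · have h1 := hm Real.two_pi_pos
    simp only [hF, hx, Circle.exp_two_pi, Circle.exp_zero] at h1
    linarith [Real.pi_pos]

lemma exists_isPrincipalCircleBundle_of_isLog {E B : Type*} [TopologicalSpace E]
    [TopologicalSpace B] [T2Space B] [CompactSpace B] {f : E → B} (hf : Continuous f)
    {φ : E → Circle} {d : ℕ} (hd : 0 < d) {c : B → CircleChart f} {g : B → E → ℝ}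
    (hc : ∀ b, b ∈ (c b).U ∧ (c b).IsLog φ d (g b)) :
    ∃ μ : Circle → E → E, IsPrincipalCircleBundle f μ := by
  obtain ⟨ρ, hρ⟩ := PartitionOfUnity.exists_isSubordinate isClosed_univ (fun b => (c b).U)
    (fun b => (c b).isOpen) (fun b _ => Set.mem_iUnion.2 ⟨b, (hc b).1⟩)
  have hG := PartitionOfUnity.continuous_average hρ (fun b => (c b).isOpen) hf
    (g := g) fun b => (hc b).2.1
  set G : E → ℝ := ρ.average f g with hGdef
  have hd' : (d : ℝ) ≠ 0 := by positivity
  have hmono : ∀ i, ∀ b ∈ (c i).U, StrictMono fun t : ℝ =>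
      t + (g i ((c i).s (b, Circle.exp t)) - G ((c i).s (b, Circle.exp t))) / d := by
    intro i b hb
    have hsum : ∀ t : ℝ,
        t + (g i ((c i).s (b, Circle.exp t)) - G ((c i).s (b, Circle.exp t))) / d =
        ∑ j ∈ ρ.finsupport b, ρ j b * (t +
          (g i ((c i).s (b, Circle.exp t)) - g j ((c i).s (b, Circle.exp t))) / d) := by
      intro t
      have h1 : ∑ j ∈ ρ.finsupport b, ρ j b = 1 := ρ.sum_finsupport trivial
      simp only [hGdef, PartitionOfUnity.average, (c i).f_s b hb]
      simp only [mul_add, mul_div_assoc', mul_sub, Finset.sum_add_distrib, ← Finset.sum_div,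
        Finset.sum_sub_distrib, ← Finset.sum_mul, h1, one_mul]
    intro t r htr
    simp only [hsum]
    refine Finset.sum_lt_sum_of_nonempty ?_ fun j hj => ?_
    · obtain ⟨j, hj⟩ := ρ.exists_pos (x := b) trivial
      exact ⟨j, (ρ.mem_finsupport b).2 hj.ne'⟩
    · exact mul_lt_mul_of_pos_left
        (CircleChart.strictMono_of_isLog hd (hc i).2 (hc j).2 hb (hρ.mem hj) htr)
        ((ρ.nonneg j b).lt_of_ne' ((ρ.mem_finsupport b).1 hj))
  have hnew := fun i => (c i).exists_chart_mul_exp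
    (((hc i).2.1.sub hG.continuousOn).div_const (d : ℝ)) (hmono i)
  choose c' hU hψ using hnew
  refine exists_isPrincipalCircleBundle_of_pow_eq hf hd
    (φ := fun x => φ x / Circle.exp (G x)) c' (fun b => hU b ▸ (hc b).1) fun b x hx => ?_
  rw [hψ, mul_pow, ← circleExp_natCast_mul, mul_div_cancel₀ _ hd', Pi.sub_apply, Circle.exp_sub,
    (hc b).2.2 x (hU b ▸ hx), mul_div_assoc]

/-- Let `(M, F)` be a non-regular A-foliation of codimension `2` on a
compact, simply-connected `(n+2)`-manifold, let `L_p` be a least singular leaf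
(homeomorphic to `Tⁿ⁻¹`) and `L_q` a nearby principal leaf (homeomorphic to `Tⁿ`).  Then
the smooth circle bundle `S¹ ↪ Tⁿ → Tⁿ⁻¹` given by the closest-point projection
`L_q → L_p` is a principal `S¹`-bundle. -/
theorem closest_point_projection_is_principal_circle_bundle
    {n : ℕ} {M : Type*} [TopologicalSpace M] [T2Space M]
    [ChartedSpace (EuclideanSpace ℝ (Fin (n + 2))) M]
    [CompactSpace M] [SimplyConnectedSpace M]
    (F : SFoliation M) (hA : F.IsAFoliation)
    (hcodim : F.dim = n) (hnonregular : ∃ p : M, ¬ F.IsRegular p)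
    -- `L_p` is a least singular leaf, homeomorphic to `Tⁿ⁻¹`:
    (p : M) (hp : F.leafDim p + 1 = n)
    (hptorus : Nonempty (↥(F.leaf p) ≃ₜ Torus (F.leafDim p)))
    -- `L_q` is a nearby principal leaf, homeomorphic to `Tⁿ`:
    (q : M) (hq : F.IsPrincipal q)
    (hqtorus : Nonempty (↥(F.leaf q) ≃ₜ Torus n))
    -- the closest-point projection, a fiber bundle with fiber `S¹`:
    (pr : C(↥(F.leaf q), ↥(F.leaf p)))
    (hpr : IsFiberBundleWithFiber Circle pr) :
    ∃ μ : Circle → ↥(F.leaf q) → ↥(F.leaf q), IsPrincipalCircleBundle pr μ := by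
  subst hp
  obtain ⟨β⟩ := hptorus
  obtain ⟨α⟩ := hqtorus
  have : CompactSpace ↥(F.leaf p) := β.symm.compactSpace
  obtain ⟨φ, d, c, g, hd, -, hc⟩ := exists_charts_isLog_pos α β hpr
  exact exists_isPrincipalCircleBundle_of_isLog pr.continuous hd hc
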